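/- Fix p and a > p−1. If X ~ W_p(a) then the sequence X/n satisfies a large deviation principle with speed n and good rate function I(X) = tr X on positive semidefinite Hermitian p×p matrices. -/

import Mathlib

open MeasureTheory Filter
open scoped ComplexOrder ENNReal Topology

attribute [local instance] Classical.propDecidable

noncomputable instance matrixMeasureSpace (p : ℕ) : MeasureSpace (Matrix (Fin p) (Fin p) ℂ) :=
  inferInstanceAs (MeasureSpace (Fin p → Fin p → ℂ))

/-- Parametrization of Hermitian matrices by their diagonal (real) entries and their
strictly upper triangular (complex) entries. -/
noncomputable def hermMk (p : ℕ)
    (x : (Fin p → ℝ) × ({q : Fin p × Fin p // q.1 < q.2} → ℂ)) :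
    Matrix (Fin p) (Fin p) ℂ :=
  Matrix.of fun i j =>
    if h : i < j then x.2 ⟨(i, j), h⟩
    else if h' : j < i then star (x.2 ⟨(j, i), h'⟩)
    else (x.1 i : ℂ)

/-- Lebesgue measure `∏_{i ≤ j} dx_{ij}^Re ∏_{i < j} dx_{ij}^Im` on the set of
Hermitian `p × p` complex matrices. -/
noncomputable def hermLebesgue (p : ℕ) : Measure (Matrix (Fin p) (Fin p) ℂ) :=
  Measure.map (hermMk p) volume

/-- Normalization of a measure into a probability measure. -/
noncomputable def mnormalize {α : Type*} [MeasurableSpace α] (μ : Measure α) : Measure α :=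
  (μ Set.univ)⁻¹ • μ

/-- The complex matrix Beta distribution `Beta_p(α, β)`, with density proportional to
`det(X)^(α-p) det(I-X)^(β-p)` on Hermitian matrices `0 < X < I`. -/
noncomputable def matrixBeta (p : ℕ) (α β : ℝ) : Measure (Matrix (Fin p) (Fin p) ℂ) :=
  mnormalize <| (hermLebesgue p).withDensity fun X =>
    if X.PosDef ∧ ((1 : Matrix (Fin p) (Fin p) ℂ) - X).PosDef then
      ENNReal.ofReal (Real.rpow X.det.re (α - p) * Real.rpow (1 - X).det.re (β - p))
    else 0

/-- The complex Wishart distribution `W_p(a)`, with density proportional to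
`det(X)^(a-p) e^(-tr X)` on positive definite Hermitian matrices. -/
noncomputable def wishart (p : ℕ) (a : ℝ) : Measure (Matrix (Fin p) (Fin p) ℂ) :=
  mnormalize <| (hermLebesgue p).withDensity fun X =>
    if X.PosDef then
      ENNReal.ofReal (Real.rpow X.det.re (a - p) * Real.exp (-X.trace.re))
    else 0

/-- The Gaussian Unitary Ensemble `GUE_p`, with density proportional to `exp(-tr(X²)/2)`
on Hermitian matrices. -/
noncomputable def gue (p : ℕ) : Measure (Matrix (Fin p) (Fin p) ℂ) :=
  mnormalize <| (hermLebesgue p).withDensity fun X =>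
    ENNReal.ofReal (Real.exp (-(X * X).trace.re / 2))

/-- Convergence in distribution of a sequence of laws to a limiting law. -/
def TendstoInDistribution {M : Type*} [MeasurableSpace M] [TopologicalSpace M]
    (μ : ℕ → Measure M) (ν : Measure M) : Prop :=
  ∀ f : BoundedContinuousFunction M ℝ,
    Tendsto (fun n => ∫ x, f x ∂(μ n)) atTop (𝓝 (∫ x, f x ∂ν))

/-- A sequence of measures satisfies a large deviation principle with speed `n` and good
rate function `I`: `I` is lower semicontinuous with compact sublevel sets, and for every
Borel set `A`,
`-inf_{Int A} I ≤ liminf (1/n) log μ_n(A) ≤ limsup (1/n) log μ_n(A) ≤ -inf_{Clo A} I`. -/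
def IsLDP {α : Type*} [TopologicalSpace α] [MeasurableSpace α]
    (μ : ℕ → Measure α) (I : α → EReal) : Prop :=
  LowerSemicontinuous I ∧ (∀ c : ℝ, IsCompact {x | I x ≤ (c : EReal)}) ∧
  ∀ A : Set α, MeasurableSet A →
    (-(⨅ x ∈ interior A, I x) ≤
        liminf (fun n : ℕ => (((n : ℝ)⁻¹ : ℝ) : EReal) * (μ n A).log) atTop ∧
      limsup (fun n : ℕ => (((n : ℝ)⁻¹ : ℝ) : EReal) * (μ n A).log) atTop ≤
        -(⨅ x ∈ closure A, I x))

instance matrixBorelSpace (p : ℕ) : BorelSpace (Matrix (Fin p) (Fin p) ℂ) :=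
  inferInstanceAs (BorelSpace (Fin p → Fin p → ℂ))

theorem Matrix.PosSemidef.norm_apply_le_trace {p : ℕ} {X : Matrix (Fin p) (Fin p) ℂ}
    (hX : X.PosSemidef) (i j : Fin p) : ‖X i j‖ ≤ X.trace.re := by
  have hdiag (k : Fin p) : 0 ≤ (X k k).re ∧ (X k k).im = 0 := by
    have h := hX.diag_nonneg (i := k)
    rw [Complex.le_def] at h
    exact ⟨h.1, h.2.symm⟩
  have hle (k : Fin p) : (X k k).re ≤ X.trace.re := by
    simp only [Matrix.trace, Matrix.diag_apply, Complex.re_sum]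
    exact Finset.single_le_sum (f := fun k => (X k k).re) (fun l _ => (hdiag l).1)
      (Finset.mem_univ k)
  have hdet := (hX.submatrix ![i, j]).det_nonneg
  rw [Matrix.det_fin_two, Complex.le_def] at hdet
  have hji : X j i = star (X i j) := (hX.isHermitian.apply j i).symm
  have hre := hdet.1
  simp [hji, Complex.mul_re, (hdiag i).2, (hdiag j).2] at hre
  have hsq : ‖X i j‖ ^ 2 = (X i j).re * (X i j).re + (X i j).im * (X i j).im := by
    rw [Complex.sq_norm, Complex.normSq_apply]
  have h0 : 0 ≤ X.trace.re := (hdiag i).1.trans (hle i)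
  refine abs_le_of_sq_le_sq' ?_ h0 |>.2
  nlinarith [hle i, hle j, (hdiag i).1, (hdiag j).1]

theorem isClosed_setOf_posSemidef (p : ℕ) :
    IsClosed {X : Matrix (Fin p) (Fin p) ℂ | X.PosSemidef} := by
  simp only [Matrix.posSemidef_iff_dotProduct_mulVec, Set.ofPred_and, Set.ofPred_forall]
  refine IsClosed.inter ?_ (isClosed_iInter fun v => ?_)
  · exact isClosed_eq (by fun_prop) continuous_id
  · exact isClosed_le continuous_const (by fun_prop)

theorem measurableSet_setOf_posDef (p : ℕ) :
    MeasurableSet {X : Matrix (Fin p) (Fin p) ℂ | X.PosDef} := by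
  have : {X : Matrix (Fin p) (Fin p) ℂ | X.PosDef} =
      {X | X.PosSemidef} ∩ {X | X.det ≠ 0} := by
    ext X
    refine ⟨fun h => ⟨h.posSemidef, h.det_pos.ne'⟩, fun h => ?_⟩
    exact h.1.posDef_iff_det_ne_zero.2 h.2
  rw [this]
  refine (isClosed_setOf_posSemidef p).measurableSet.inter (IsOpen.measurableSet ?_)
  exact isOpen_ne_fun (by fun_prop) continuous_const

theorem Matrix.PosDef.eventually_posDef {p : ℕ} {X : Matrix (Fin p) (Fin p) ℂ} (hX : X.PosDef) :
    ∀ᶠ Y in 𝓝 X, Y.IsHermitian → Y.PosDef := by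
  have hK := isCompact_sphere (0 : Fin p → ℂ) 1
  have key := hK.eventually_forall_of_forall_eventually (x₀ := X)
    (P := fun Y v => 0 < (star v ⬝ᵥ Y.mulVec v).re) (fun v hv => by
      have hv0 : v ≠ 0 := by
        rintro rfl
        simp at hv
      have hpos := (Complex.lt_def.1 (hX.dotProduct_mulVec_pos hv0)).1
      have hc : Continuous fun z : Matrix (Fin p) (Fin p) ℂ × (Fin p → ℂ) =>
          (star z.2 ⬝ᵥ z.1.mulVec z.2).re := by fun_prop
      exact hc.continuousAt.eventually (lt_mem_nhds hpos))
  filter_upwards [key] with Y hY hH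
  refine Matrix.PosDef.of_dotProduct_mulVec_pos hH fun v hv => ?_
  have hn : 0 < ‖v‖ := norm_pos_iff.2 hv
  have h1 := hY ((‖v‖⁻¹ : ℝ) • v) (by simp [norm_smul, hn.ne'])
  have him := hH.im_star_dotProduct_mulVec_self v
  rw [Complex.lt_def]
  refine ⟨?_, him.symm⟩
  simp only [Matrix.mulVec_smul, star_smul, smul_dotProduct, dotProduct_smul, Complex.smul_re,
    smul_eq_mul, star_trivial] at h1
  have hn' : 0 ≤ ‖v‖⁻¹ := by positivity
  simpa using pos_of_mul_pos_right (pos_of_mul_pos_right h1 hn') hn'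

/-- The unnormalized density `det(X)^κ e^(-ε tr X)` on positive definite matrices. -/
noncomputable def wishartWeight {p : ℕ} (κ ε : ℝ) (X : Matrix (Fin p) (Fin p) ℂ) : ℝ≥0∞ :=
  if X.PosDef then ENNReal.ofReal (X.det.re ^ κ * Real.exp (-(ε * X.trace.re))) else 0

theorem measurable_wishartWeight {p : ℕ} (κ ε : ℝ) :
    Measurable (wishartWeight κ ε : Matrix (Fin p) (Fin p) ℂ → ℝ≥0∞) := by
  refine Measurable.ite (measurableSet_setOf_posDef p) ?_ measurable_const
  have h1 : Measurable fun X : Matrix (Fin p) (Fin p) ℂ => X.det.re :=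
    Continuous.measurable (by fun_prop)
  have h2 : Measurable fun X : Matrix (Fin p) (Fin p) ℂ => X.trace.re :=
    Continuous.measurable (by fun_prop)
  fun_prop

theorem continuous_hermMk (p : ℕ) : Continuous (hermMk p) := by
  refine continuous_matrix fun i j => ?_
  simp only [hermMk, Matrix.of_apply]
  split_ifs <;> fun_prop

theorem isHermitian_hermMk (p : ℕ) (x) : (hermMk p x).IsHermitian := by
  ext i j
  rcases lt_trichotomy i j with h | h | h
  · simp [hermMk, h, h.not_gt]
  · simp [hermMk, h]
  · simp [hermMk, h, h.not_gt]

theorem Matrix.IsHermitian.exists_hermMk_eq {p : ℕ} {X : Matrix (Fin p) (Fin p) ℂ}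
    (hX : X.IsHermitian) : ∃ x, hermMk p x = X := by
  refine ⟨(fun i => (X i i).re, fun q => X q.1.1 q.1.2), ?_⟩
  ext i j
  rcases lt_trichotomy i j with h | h | h
  · simp [hermMk, h]
  · subst h
    simpa [hermMk] using hX.coe_re_apply_self i
  · simpa [hermMk, h, h.not_gt] using hX.apply i j

theorem hermMk_smul (p : ℕ) (r : ℝ) (x) : hermMk p (r • x) = r • hermMk p x := by
  ext i j
  simp only [hermMk, Matrix.of_apply, Matrix.smul_apply]
  split_ifs <;> simp

theorem hermMk_eq_diagonal_add (p : ℕ) (d : Fin p → ℝ) (z) :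
    hermMk p (d, z) = Matrix.diagonal (fun i => (d i : ℂ)) + hermMk p (0, z) := by
  ext i j
  rcases lt_trichotomy i j with h | h | h
  · simp [hermMk, h, h.ne]
  · simp [hermMk, h]
  · simp [hermMk, h.ne', h, h.not_gt]

theorem wishartWeight_of_posDef {p : ℕ} {κ ε : ℝ} {X : Matrix (Fin p) (Fin p) ℂ}
    (hX : X.PosDef) :
    wishartWeight κ ε X = ENNReal.ofReal (X.det.re ^ κ * Real.exp (-(ε * X.trace.re))) :=
  if_pos hX

theorem wishartWeight_of_not_posDef {p : ℕ} {κ ε : ℝ} {X : Matrix (Fin p) (Fin p) ℂ}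
    (hX : ¬X.PosDef) : wishartWeight κ ε X = 0 :=
  if_neg hX

theorem Matrix.PosDef.det_re_pos {p : ℕ} {X : Matrix (Fin p) (Fin p) ℂ} (hX : X.PosDef) :
    0 < X.det.re :=
  (Complex.lt_def.1 hX.det_pos).1

/-- Expansion of a determinant along the Schur complement of the trailing principal block. -/
theorem Matrix.det_succ_schur {p : ℕ} (X : Matrix (Fin (p + 1)) (Fin (p + 1)) ℂ)
    (hY : IsUnit (X.submatrix Fin.succ Fin.succ)) :
    X.det = (X.submatrix Fin.succ Fin.succ).det *
      (X 0 0 - (fun j => X 0 (Fin.succ j)) ⬝ᵥ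
        ((X.submatrix Fin.succ Fin.succ)⁻¹).mulVec fun k => X (Fin.succ k) 0) := by
  have hbij : Function.Bijective
      (Sum.elim (fun _ => 0) Fin.succ : Unit ⊕ Fin p → Fin (p + 1)) := by
    constructor
    · rintro (a | a) (b | b) h
      · rfl
      · exact absurd h.symm (Fin.succ_ne_zero b)
      · exact absurd h (Fin.succ_ne_zero a)
      · exact congrArg Sum.inr (Fin.succ_injective p h)
    · intro i
      refine Fin.cases ⟨Sum.inl (), rfl⟩ (fun j => ⟨Sum.inr j, rfl⟩) i
  have hblocks : X.submatrix (Equiv.ofBijective _ hbij) (Equiv.ofBijective _ hbij) =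
      Matrix.fromBlocks (Matrix.of fun _ _ => X 0 0) (Matrix.of fun _ j => X 0 (Fin.succ j))
        (Matrix.of fun k _ => X (Fin.succ k) 0) (X.submatrix Fin.succ Fin.succ) := by
    ext (i | i) (j | j) <;> simp
  have := hY.invertible
  rw [← Matrix.det_submatrix_equiv_self (Equiv.ofBijective _ hbij), hblocks,
    Matrix.det_fromBlocks₂₂, Matrix.det_unique (n := Unit), Matrix.invOf_eq_nonsing_inv,
    Matrix.mul_assoc]
  simp [Matrix.mul_apply, dotProduct, Matrix.mulVec]

theorem lintegral_rpow_mul_exp_neg_lt_top {κ ε : ℝ} (hκ : -1 < κ) (hε : 0 < ε) :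
    ∫⁻ u in Set.Ioi (0 : ℝ), ENNReal.ofReal (u ^ κ * Real.exp (-(ε * u))) < ∞ := by
  have h := (integrableOn_rpow_mul_exp_neg_mul_rpow hκ one_pos hε).lintegral_lt_top
  simpa using h

/-- Integrating one diagonal entry against the Wishart density leaves a multiple of the Wishart
density of the complementary principal block. -/
theorem lintegral_wishartWeight_cons_le {p : ℕ} (κ : ℝ) {ε : ℝ} (hε : 0 < ε)
    (H : Matrix (Fin (p + 1)) (Fin (p + 1)) ℂ) (hH : ∀ i, H i i = 0) (d : Fin p → ℝ) :
    ∫⁻ t : ℝ, wishartWeight κ ε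
        (Matrix.diagonal (fun i => ((Fin.cons t d : Fin (p + 1) → ℝ) i : ℂ)) + H) ≤
      (∫⁻ u in Set.Ioi (0 : ℝ), ENNReal.ofReal (u ^ κ * Real.exp (-(ε * u)))) *
        wishartWeight κ ε
          (Matrix.diagonal (fun i => (d i : ℂ)) + H.submatrix Fin.succ Fin.succ) := by
  set Y := Matrix.diagonal (fun i => (d i : ℂ)) + H.submatrix Fin.succ Fin.succ with hYdef
  set X : ℝ → Matrix (Fin (p + 1)) (Fin (p + 1)) ℂ := fun t =>
    Matrix.diagonal (fun i => ((Fin.cons t d : Fin (p + 1) → ℝ) i : ℂ)) + H with hXdef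
  have hsub (t : ℝ) : (X t).submatrix Fin.succ Fin.succ = Y := by
    ext i j
    by_cases h : i = j
    · subst h; simp [hXdef, hYdef]
    · simp [hXdef, hYdef, h]
  have h00 (t : ℝ) : X t 0 0 = t := by simp [hXdef, hH]
  have h0s (t : ℝ) (j : Fin p) : X t 0 j.succ = H 0 j.succ := by
    simp [hXdef, (Fin.succ_ne_zero j).symm]
  have hs0 (t : ℝ) (j : Fin p) : X t j.succ 0 = H j.succ 0 := by
    simp [hXdef]
  set q : ℂ := (fun j => H 0 (Fin.succ j)) ⬝ᵥ Y⁻¹.mulVec fun k => H (Fin.succ k) 0 with hq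
  set g : ℝ → ℝ≥0∞ := (Set.Ioi (0 : ℝ)).indicator fun u =>
    ENNReal.ofReal (u ^ κ * Real.exp (-(ε * u))) with hg
  have hgm : Measurable g := by
    refine Measurable.indicator ?_ measurableSet_Ioi
    fun_prop
  have hpt (t : ℝ) : wishartWeight κ ε (X t) ≤ g (t - q.re) * wishartWeight κ ε Y := by
    by_cases hX : (X t).PosDef
    swap
    · simp [wishartWeight_of_not_posDef hX]
    have hY : Y.PosDef := hsub t ▸ hX.submatrix (Fin.succ_injective p)
    have hdet := (X t).det_succ_schur (by rw [hsub]; exact hY.isUnit)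
    simp only [hsub, h00, h0s, hs0, ← hq] at hdet
    have hb : (fun j => H 0 (Fin.succ j)) = star fun k => H (Fin.succ k) 0 := by
      funext j
      have := hX.isHermitian.apply 0 j.succ
      rw [hs0, h0s] at this
      exact this.symm
    have hq0 : 0 ≤ q := by
      rw [hq, hb]
      exact hY.inv.posSemidef.dotProduct_mulVec_nonneg _
    have hYd := Complex.lt_def.1 hY.det_pos
    have hdre : (X t).det.re = Y.det.re * (t - q.re) := by
      rw [hdet, Complex.mul_re, ← hYd.2]
      simp
    have hu : 0 < t - q.re := by
      have := hX.det_re_pos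
      rw [hdre] at this
      exact pos_of_mul_pos_right this hY.det_re_pos.le
    have htr : (X t).trace.re = t + Y.trace.re := by
      simp [Matrix.trace, hXdef, hYdef, Fin.sum_univ_succ, hH]
    rw [wishartWeight_of_posDef hX, wishartWeight_of_posDef hY, hg,
      Set.indicator_of_mem (Set.mem_Ioi.2 hu), ← ENNReal.ofReal_mul (by positivity), hdre, htr,
      Real.mul_rpow hY.det_re_pos.le hu.le]
    refine ENNReal.ofReal_le_ofReal ?_
    have hexp : Real.exp (-(ε * (t + Y.trace.re))) ≤
        Real.exp (-(ε * (t - q.re))) * Real.exp (-(ε * Y.trace.re)) := by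
      rw [← Real.exp_add]
      refine Real.exp_le_exp.2 ?_
      have : 0 ≤ ε * q.re := mul_nonneg hε.le (Complex.le_def.1 hq0).1
      linarith
    have hc : 0 ≤ Y.det.re ^ κ * (t - q.re) ^ κ :=
      mul_nonneg (Real.rpow_nonneg hY.det_re_pos.le _) (Real.rpow_nonneg hu.le _)
    calc _ ≤ _ := mul_le_mul_of_nonneg_left hexp hc
      _ = _ := by ring
  calc ∫⁻ t : ℝ, wishartWeight κ ε (X t)
      ≤ ∫⁻ t : ℝ, g (t - q.re) * wishartWeight κ ε Y := lintegral_mono hpt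
    _ = (∫⁻ t : ℝ, g (t - q.re)) * wishartWeight κ ε Y :=
        lintegral_mul_const _ (by fun_prop)
    _ = _ := by
        rw [lintegral_sub_right_eq_self g, hg, lintegral_indicator measurableSet_Ioi]

/-- The integral of the Wishart density over the diagonal entries is bounded uniformly in the
off-diagonal entries. -/
theorem lintegral_wishartWeight_diagonal_le {p : ℕ} (κ : ℝ) {ε : ℝ} (hε : 0 < ε)
    (H : Matrix (Fin p) (Fin p) ℂ) (hH : ∀ i, H i i = 0) :
    ∫⁻ d : Fin p → ℝ, wishartWeight κ ε (Matrix.diagonal (fun i => (d i : ℂ)) + H) ≤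
      (∫⁻ u in Set.Ioi (0 : ℝ), ENNReal.ofReal (u ^ κ * Real.exp (-(ε * u)))) ^ p := by
  induction p with
  | zero =>
    have (d : Fin 0 → ℝ) :
        wishartWeight κ ε (Matrix.diagonal (fun i => (d i : ℂ)) + H) ≤ 1 := by
      unfold wishartWeight
      split_ifs <;> simp [Matrix.trace]
    refine (lintegral_mono this).trans ?_
    simp [volume_pi]
  | succ p ih =>
    have hmp := (volume_preserving_piFinSuccAbove (fun _ : Fin (p + 1) => ℝ) 0).symm
    have hmeas : Measurable fun x : ℝ × (Fin p → ℝ) => wishartWeight κ ε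
        (Matrix.diagonal (fun i => ((Fin.cons x.1 x.2 : Fin (p + 1) → ℝ) i : ℂ)) + H) := by
      refine (measurable_wishartWeight κ ε).comp (Continuous.measurable ?_)
      refine (Continuous.matrix_diagonal ?_).add continuous_const
      refine continuous_pi fun i => ?_
      refine Fin.cases ?_ (fun j => ?_) i
      · simp only [Fin.cons_zero]; fun_prop
      · simp only [Fin.cons_succ]; fun_prop
    rw [← hmp.lintegral_comp_emb (MeasurableEquiv.measurableEmbedding _)]
    simp only [MeasurableEquiv.piFinSuccAbove_symm_apply, Fin.insertNthEquiv_apply,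
      Fin.insertNth_zero']
    rw [Measure.volume_eq_prod, lintegral_prod_symm _ hmeas.aemeasurable]
    refine (lintegral_mono fun d => lintegral_wishartWeight_cons_le κ hε H hH d).trans ?_
    rw [lintegral_const_mul _ ?_, pow_succ']
    · gcongr
      exact ih _ fun i => hH _
    · refine (measurable_wishartWeight κ ε).comp (Continuous.measurable ?_)
      fun_prop

theorem lintegral_exp_neg_mul_norm_lt_top {E : Type*} [NormedAddCommGroup E] [NormedSpace ℝ E]
    [FiniteDimensional ℝ E] [MeasurableSpace E] [BorelSpace E] (μ : Measure E)
    [μ.IsAddHaarMeasure] {c : ℝ} (hc : 0 < c) :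
    ∫⁻ z, ENNReal.ofReal (Real.exp (-(c * ‖z‖))) ∂μ < ∞ := by
  set r : ℝ := Module.finrank ℝ E + 1 with hr
  have hcont : ContinuousOn (fun u : ℝ => (1 + u) ^ r * Real.exp (-(c * u))) (Set.Ici 0) := by
    intro u hu
    have : 1 + u ≠ 0 := by have := Set.mem_Ici.1 hu; positivity
    fun_prop (disch := simp [this])
  have hlim : Tendsto (fun u : ℝ => (1 + u) ^ r * Real.exp (-(c * u))) atTop (𝓝 0) := by
    have h := (tendsto_rpow_mul_exp_neg_mul_atTop_nhds_zero r c hc).comp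
      (tendsto_atTop_add_const_left atTop (1 : ℝ) tendsto_id)
    have h2 := h.const_mul (Real.exp c)
    rw [mul_zero] at h2
    refine h2.congr fun u => ?_
    simp only [Function.comp, id]
    rw [mul_left_comm, ← Real.exp_add]
    congr 2
    ring
  obtain ⟨M, hM⟩ : ∃ M : ℝ, ∀ u, 0 ≤ u → (1 + u) ^ r * Real.exp (-(c * u)) ≤ M := by
    obtain ⟨R, hR⟩ := eventually_atTop.1 (hlim.eventually (gt_mem_nhds one_pos))
    obtain ⟨M, hM⟩ := (isCompact_Icc (a := (0 : ℝ)) (b := R)).bddAbove_image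
      (hcont.mono fun u hu => hu.1)
    refine ⟨max M 1, fun u hu => ?_⟩
    rcases le_total u R with h | h
    · exact le_max_of_le_left (hM ⟨u, ⟨hu, h⟩, rfl⟩)
    · exact le_max_of_le_right (hR u h).le
  have hle (z : E) : ENNReal.ofReal (Real.exp (-(c * ‖z‖))) ≤
      ENNReal.ofReal M * ENNReal.ofReal ((1 + ‖z‖) ^ (-r)) := by
    rw [← ENNReal.ofReal_mul' (by positivity)]
    refine ENNReal.ofReal_le_ofReal ?_
    have hpos : 0 < (1 + ‖z‖) ^ r := by positivity
    rw [Real.rpow_neg (by positivity), ← div_eq_mul_inv, le_div_iff₀ hpos, mul_comm]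
    exact hM _ (norm_nonneg z)
  refine (lintegral_mono hle).trans_lt ?_
  rw [lintegral_const_mul' _ _ ENNReal.ofReal_ne_top]
  exact ENNReal.mul_lt_top ENNReal.ofReal_lt_top (finite_integral_one_add_norm (by simp [hr]))

theorem lintegral_hermLebesgue {p : ℕ} {f : Matrix (Fin p) (Fin p) ℂ → ℝ≥0∞}
    (hf : Measurable f) : ∫⁻ X, f X ∂hermLebesgue p = ∫⁻ x, f (hermMk p x) :=
  lintegral_map hf (continuous_hermMk p).measurable

theorem lintegral_wishartWeight_lt_top (p : ℕ) {κ ε : ℝ} (hκ : -1 < κ) (hε : 0 < ε) :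
    ∫⁻ X, wishartWeight κ ε X ∂hermLebesgue p < ∞ := by
  have hpt (d : Fin p → ℝ) (z : {q : Fin p × Fin p // q.1 < q.2} → ℂ) :
      wishartWeight κ ε (hermMk p (d, z)) ≤ ENNReal.ofReal (Real.exp (-(ε / 2 * ‖z‖))) *
        wishartWeight κ (ε / 2) (hermMk p (d, z)) := by
    by_cases hX : (hermMk p (d, z)).PosDef
    swap
    · simp [wishartWeight_of_not_posDef hX]
    have hdet := hX.det_re_pos
    have hz : ‖z‖ ≤ (hermMk p (d, z)).trace.re := by
      refine (pi_norm_le_iff_of_nonneg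
        (Complex.le_def.1 hX.posSemidef.trace_nonneg).1).2 fun q => ?_
      simpa [hermMk, q.2] using hX.posSemidef.norm_apply_le_trace q.1.1 q.1.2
    rw [wishartWeight_of_posDef hX, wishartWeight_of_posDef hX,
      ← ENNReal.ofReal_mul (by positivity), mul_left_comm, ← Real.exp_add]
    refine ENNReal.ofReal_le_ofReal (mul_le_mul_of_nonneg_left (Real.exp_le_exp.2 ?_)
      (by positivity))
    nlinarith
  have hmeas : Measurable fun x => wishartWeight κ ε (hermMk p x) :=
    (measurable_wishartWeight κ ε).comp (continuous_hermMk p).measurable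
  rw [lintegral_hermLebesgue (measurable_wishartWeight κ ε), Measure.volume_eq_prod,
    lintegral_prod_symm _ hmeas.aemeasurable]
  set C := (∫⁻ u in Set.Ioi (0 : ℝ), ENNReal.ofReal (u ^ κ * Real.exp (-(ε / 2 * u)))) ^ p
    with hCdef
  have hC : C < ∞ := ENNReal.pow_lt_top (lintegral_rpow_mul_exp_neg_lt_top hκ (half_pos hε))
  have hz (z : {q : Fin p × Fin p // q.1 < q.2} → ℂ) :
      ∫⁻ d : Fin p → ℝ, wishartWeight κ ε (hermMk p (d, z)) ≤
        ENNReal.ofReal (Real.exp (-(ε / 2 * ‖z‖))) * C := by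
    refine ((lintegral_mono fun d => hpt d z).trans_eq
      (lintegral_const_mul' _ _ ENNReal.ofReal_ne_top)).trans (mul_le_mul_right ?_ _)
    refine (lintegral_congr fun d => congrArg _ (hermMk_eq_diagonal_add p d z)).trans_le ?_
    exact lintegral_wishartWeight_diagonal_le κ (half_pos hε) _ fun i => by simp [hermMk]
  refine (lintegral_mono hz).trans_lt ?_
  rw [lintegral_mul_const' _ _ hC.ne]
  exact ENNReal.mul_lt_top (lintegral_exp_neg_mul_norm_lt_top _ (half_pos hε)) hC

theorem exists_hermMk_nhds_posDef {p : ℕ} {G : Set (Matrix (Fin p) (Fin p) ℂ)} (hG : IsOpen G)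
    {X : Matrix (Fin p) (Fin p) ℂ} (hXG : X ∈ G) (hX : X.PosDef) (κ : ℝ) {τ : ℝ}
    (hτ : X.trace.re < τ) :
    ∃ U : Set ((Fin p → ℝ) × ({q : Fin p × Fin p // q.1 < q.2} → ℂ)), IsOpen U ∧ U.Nonempty ∧
      ∃ c > 0, ∀ x ∈ U, hermMk p x ∈ G ∧ (hermMk p x).PosDef ∧
        (hermMk p x).trace.re < τ ∧ c < (hermMk p x).det.re ^ κ := by
  obtain ⟨x₀, rfl⟩ := hX.isHermitian.exists_hermMk_eq
  have hc := (continuous_hermMk p).tendsto x₀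
  have hdet : ContinuousAt (fun x => (hermMk p x).det.re ^ κ) x₀ := by
    refine ContinuousAt.rpow_const ?_ (Or.inl hX.det_re_pos.ne')
    have := continuous_hermMk p
    fun_prop
  have htr : Continuous fun x => (hermMk p x).trace.re := by
    have := continuous_hermMk p
    fun_prop
  have hpos : 0 < (hermMk p x₀).det.re ^ κ := Real.rpow_pos_of_pos hX.det_re_pos κ
  have hev : ∀ᶠ x in 𝓝 x₀, hermMk p x ∈ G ∧ (hermMk p x).PosDef ∧
      (hermMk p x).trace.re < τ ∧ (hermMk p x₀).det.re ^ κ / 2 < (hermMk p x).det.re ^ κ := by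
    filter_upwards [hc.eventually (hG.mem_nhds hXG), hc.eventually hX.eventually_posDef,
      htr.continuousAt.eventually (gt_mem_nhds hτ),
      hdet.eventually (lt_mem_nhds (half_lt_self hpos))] with x h1 h2 h3 h4
    exact ⟨h1, h2 (isHermitian_hermMk p x), h3, h4⟩
  obtain ⟨U, hU, hUo, hx₀⟩ := eventually_nhds_iff.1 hev
  exact ⟨U, hUo, ⟨x₀, hx₀⟩, _, half_pos hpos, hU⟩

theorem Matrix.PosDef.smul_real {p : ℕ} {X : Matrix (Fin p) (Fin p) ℂ} (hX : X.PosDef) {r : ℝ}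
    (hr : 0 < r) : (r • X).PosDef := by
  have := hX.smul (a := (r : ℂ)) (by simpa using hr)
  simpa using this

theorem wishartWeight_smul {p : ℕ} {κ ε r : ℝ} {X : Matrix (Fin p) (Fin p) ℂ} (hX : X.PosDef)
    (hr : 0 < r) : wishartWeight κ ε (r • X) = ENNReal.ofReal
      (r ^ (p * κ) * X.det.re ^ κ * Real.exp (-(ε * (r * X.trace.re)))) := by
  rw [wishartWeight_of_posDef (hX.smul_real hr)]
  have hdet : (r • X).det.re = r ^ p * X.det.re := by
    have h : r • X = (r : ℂ) • X := by ext; simp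
    rw [h, Matrix.det_smul, ← Complex.ofReal_pow, Complex.re_ofReal_mul, Fintype.card_fin]
  have htr : (r • X).trace.re = r * X.trace.re := by simp [Matrix.trace_smul]
  rw [hdet, htr, Real.mul_rpow (by positivity) hX.det_re_pos.le, ← Real.rpow_natCast,
    ← Real.rpow_mul hr.le]

open scoped Pointwise in
theorem exists_le_setLIntegral_wishartWeight {p : ℕ} {A : Set (Matrix (Fin p) (Fin p) ℂ)}
    (hA : MeasurableSet A) {X : Matrix (Fin p) (Fin p) ℂ} (hXA : X ∈ interior A)
    (hX : X.PosDef) (κ : ℝ) {τ : ℝ} (hτ : X.trace.re < τ) :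
    ∃ k > 0, ∀ n : ℕ, 1 ≤ n → ENNReal.ofReal (k * ((n : ℝ) ^ (p * κ) * Real.exp (-(n * τ)))) ≤
      ∫⁻ Y in (fun Y => (n : ℝ)⁻¹ • Y) ⁻¹' A, wishartWeight κ 1 Y ∂hermLebesgue p := by
  have : (volume : Measure ((Fin p → ℝ) ×
      ({q : Fin p × Fin p // q.1 < q.2} → ℂ))).IsAddHaarMeasure :=
    Measure.prod.instIsAddHaarMeasure _ _
  obtain ⟨U, hUo, hUne, c, hc, hU⟩ :=
    exists_hermMk_nhds_posDef isOpen_interior hXA hX κ hτ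
  obtain ⟨v, hv0, hv⟩ : ∃ v : ℝ, 0 < v ∧ ENNReal.ofReal v ≤ volume U := by
    obtain ⟨v, hv0, hv⟩ := ENNReal.lt_iff_exists_nnreal_btwn.1 (hUo.measure_pos volume hUne)
    exact ⟨v, by simpa using hv0, by simpa using hv.le⟩
  refine ⟨v * c, by positivity, fun n hn => ?_⟩
  have hn0 : (0 : ℝ) < n := by positivity
  have hn1 : (1 : ℝ) ≤ n := by exact_mod_cast hn
  have hms : MeasurableSet ((fun Y : Matrix (Fin p) (Fin p) ℂ => (n : ℝ)⁻¹ • Y) ⁻¹' A) :=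
    (continuous_const_smul _).measurable hA
  have hmU : MeasurableSet ((n : ℝ) • U) := (hUo.smul₀ hn0.ne').measurableSet
  have hvol : volume U ≤ volume ((n : ℝ) • U) := by
    rw [Measure.addHaar_smul, abs_of_nonneg (by positivity)]
    exact le_mul_of_one_le_left' (ENNReal.one_le_ofReal.2 (one_le_pow₀ hn1))
  rw [← lintegral_indicator hms,
    lintegral_hermLebesgue ((measurable_wishartWeight κ 1).indicator hms)]
  set K : ℝ := (n : ℝ) ^ (p * κ) * c * Real.exp (-(n * τ)) with hK
  have hK0 : 0 ≤ K := by positivity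
  calc ENNReal.ofReal (v * c * ((n : ℝ) ^ (p * κ) * Real.exp (-(n * τ))))
      = ENNReal.ofReal K * ENNReal.ofReal v := by
        rw [← ENNReal.ofReal_mul hK0, hK]
        congr 1
        ring
    _ ≤ ENNReal.ofReal K * volume ((n : ℝ) • U) := by
        gcongr
        exact hv.trans hvol
    _ = ∫⁻ _ in (n : ℝ) • U, ENNReal.ofReal K := (setLIntegral_const _ _).symm
    _ ≤ ∫⁻ x in (n : ℝ) • U,
          Set.indicator ((fun Y => (n : ℝ)⁻¹ • Y) ⁻¹' A) (wishartWeight κ 1) (hermMk p x) := by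
        refine setLIntegral_mono' hmU ?_
        rintro _ ⟨x, hx, rfl⟩
        obtain ⟨h1, h2, h3, h4⟩ := hU x hx
        simp only [hermMk_smul]
        rw [Set.indicator_of_mem, wishartWeight_smul h2 hn0]
        · refine ENNReal.ofReal_le_ofReal ?_
          rw [one_mul, hK]
          have hd := Real.rpow_nonneg h2.det_re_pos.le κ
          gcongr
        · simpa [smul_smul, hn0.ne'] using interior_subset h1
    _ ≤ _ := setLIntegral_le_lintegral _ _

theorem wishart_eq_smul_withDensity (p : ℕ) (a : ℝ) :
    wishart p a = (∫⁻ X, wishartWeight (a - p) 1 X ∂hermLebesgue p)⁻¹ •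
      (hermLebesgue p).withDensity (wishartWeight (a - p) 1) := by
  have h : (fun X : Matrix (Fin p) (Fin p) ℂ => if X.PosDef then
      ENNReal.ofReal (Real.rpow X.det.re (a - p) * Real.exp (-X.trace.re)) else 0) =
      wishartWeight (a - p) 1 := by
    funext X
    simp only [wishartWeight, one_mul]
    rfl
  rw [wishart, mnormalize, h, withDensity_apply _ MeasurableSet.univ, Measure.restrict_univ]

theorem map_smul_wishart_apply (p : ℕ) (a : ℝ) (n : ℕ) {A : Set (Matrix (Fin p) (Fin p) ℂ)}
    (hA : MeasurableSet A) :
    Measure.map (fun X : Matrix (Fin p) (Fin p) ℂ => (n : ℝ)⁻¹ • X) (wishart p a) A =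
      (∫⁻ X, wishartWeight (a - p) 1 X ∂hermLebesgue p)⁻¹ *
        ∫⁻ X in (fun X => (n : ℝ)⁻¹ • X) ⁻¹' A, wishartWeight (a - p) 1 X ∂hermLebesgue p := by
  have hm : Measurable fun X : Matrix (Fin p) (Fin p) ℂ => (n : ℝ)⁻¹ • X :=
    (continuous_const_smul _).measurable
  rw [Measure.map_apply hm hA, wishart_eq_smul_withDensity, Measure.smul_apply, smul_eq_mul,
    withDensity_apply _ (hm hA)]

theorem lintegral_wishartWeight_pos (p : ℕ) (κ : ℝ) :
    0 < ∫⁻ X, wishartWeight κ 1 X ∂hermLebesgue p := by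
  obtain ⟨k, hk, h⟩ := exists_le_setLIntegral_wishartWeight (p := p) MeasurableSet.univ
    (X := 1) (by simp) Matrix.PosDef.one κ (lt_add_one _)
  refine lt_of_lt_of_le ?_ ((h 1 le_rfl).trans (setLIntegral_le_lintegral _ _))
  rw [ENNReal.ofReal_pos]
  positivity

theorem eventually_le_map_smul_wishart {p : ℕ} {a : ℝ} (ha : (p : ℝ) - 1 < a)
    {A : Set (Matrix (Fin p) (Fin p) ℂ)} (hA : MeasurableSet A)
    {X : Matrix (Fin p) (Fin p) ℂ} (hXA : X ∈ interior A) (hX : X.PosDef) {t : ℝ}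
    (ht : X.trace.re < t) :
    ∀ᶠ n : ℕ in atTop, ENNReal.ofReal (Real.exp (-(n * t))) ≤
      Measure.map (fun X : Matrix (Fin p) (Fin p) ℂ => (n : ℝ)⁻¹ • X) (wishart p a) A := by
  obtain ⟨τ, hτ1, hτ2⟩ := exists_between ht
  obtain ⟨k, hk, h⟩ := exists_le_setLIntegral_wishartWeight hA hXA hX (a - p) hτ1
  set Z := ∫⁻ X, wishartWeight (a - p) 1 X ∂hermLebesgue p with hZ
  have hZtop : Z ≠ ∞ := (lintegral_wishartWeight_lt_top p (by linarith) one_pos).ne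
  have hZ0 : 0 < Z := lintegral_wishartWeight_pos p _
  have hz : 0 < Z.toReal := ENNReal.toReal_pos hZ0.ne' hZtop
  have hlim := (tendsto_exp_mul_div_rpow_atTop (-(p * (a - p))) (t - τ) (by linarith)).comp
    (tendsto_natCast_atTop_atTop (R := ℝ))
  filter_upwards [hlim.eventually_ge_atTop (Z.toReal / k), eventually_ge_atTop 1] with n hn hn1
  have hn0 : (0 : ℝ) < n := by positivity
  rw [map_smul_wishart_apply p a n hA]
  refine le_trans ?_ (mul_le_mul_right (h n hn1) _)
  rw [← hZ, ← ENNReal.ofReal_toReal hZtop, ← ENNReal.ofReal_inv_of_pos hz,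
    ← ENNReal.ofReal_mul (by positivity)]
  refine ENNReal.ofReal_le_ofReal ?_
  simp only [Function.comp] at hn
  rw [Real.rpow_neg hn0.le, div_inv_eq_mul, div_le_iff₀ hk] at hn
  rw [inv_mul_eq_div, le_div_iff₀ hz]
  have hexp : Real.exp (-(n * τ)) = Real.exp ((t - τ) * n) * Real.exp (-(n * t)) := by
    rw [← Real.exp_add]
    congr 1
    ring
  rw [hexp]
  nlinarith [mul_le_mul_of_nonneg_left hn (Real.exp_pos (-(n * t))).le]

theorem eventually_map_smul_wishart_le {p : ℕ} {a : ℝ} (ha : (p : ℝ) - 1 < a)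
    {A : Set (Matrix (Fin p) (Fin p) ℂ)} (hA : MeasurableSet A) {t s : ℝ} (hst : s < t)
    (ht : ∀ X ∈ A, X.PosSemidef → t ≤ X.trace.re) :
    ∀ᶠ n : ℕ in atTop,
      Measure.map (fun X : Matrix (Fin p) (Fin p) ℂ => (n : ℝ)⁻¹ • X) (wishart p a) A ≤
        ENNReal.ofReal (Real.exp (-(n * s))) := by
  obtain ⟨ε, hε0, hε1, hε⟩ : ∃ ε : ℝ, 0 < ε ∧ ε ≤ 1 ∧ s < (1 - ε) * t := by
    have hlim : Tendsto (fun ε : ℝ => (1 - ε) * t) (𝓝[>] 0) (𝓝 ((1 - 0) * t)) :=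
      (Continuous.tendsto (by fun_prop) 0).mono_left nhdsWithin_le_nhds
    obtain ⟨ε, h1, h2⟩ := ((hlim.eventually (lt_mem_nhds (by linarith : s < (1 - 0) * t))).and
      (Ioc_mem_nhdsGT one_pos)).exists
    exact ⟨ε, h2.1, h2.2, h1⟩
  set κ := a - p with hκdef
  have hκ : -1 < κ := by linarith
  set Z := ∫⁻ X, wishartWeight κ 1 X ∂hermLebesgue p with hZ
  set Zε := ∫⁻ X, wishartWeight κ ε X ∂hermLebesgue p with hZε
  have hC : Z⁻¹ * Zε ≠ ∞ := ENNReal.mul_ne_top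
    (ENNReal.inv_ne_top.2 (lintegral_wishartWeight_pos p κ).ne')
    (lintegral_wishartWeight_lt_top p hκ hε0).ne
  have hlim : Tendsto (fun n : ℕ => Real.exp (((1 - ε) * t - s) * n)) atTop atTop :=
    Real.tendsto_exp_atTop.comp
      (tendsto_natCast_atTop_atTop.const_mul_atTop (by linarith))
  filter_upwards [hlim.eventually_ge_atTop (Z⁻¹ * Zε).toReal, eventually_ge_atTop 1] with n hn hn1
  have hn0 : (0 : ℝ) < n := by positivity
  have hms : MeasurableSet ((fun Y : Matrix (Fin p) (Fin p) ℂ => (n : ℝ)⁻¹ • Y) ⁻¹' A) :=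
    (continuous_const_smul _).measurable hA
  have hpt : ∀ X ∈ (fun Y : Matrix (Fin p) (Fin p) ℂ => (n : ℝ)⁻¹ • Y) ⁻¹' A,
      wishartWeight κ 1 X ≤
        ENNReal.ofReal (Real.exp (-(n * ((1 - ε) * t)))) * wishartWeight κ ε X := by
    intro X hXA
    by_cases hX : X.PosDef
    swap
    · simp [wishartWeight_of_not_posDef hX]
    have htr := ht _ hXA (hX.smul_real (inv_pos.2 hn0)).posSemidef
    rw [Matrix.trace_smul, Complex.smul_re, smul_eq_mul, inv_mul_eq_div, le_div_iff₀ hn0] at htr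
    have hdet := hX.det_re_pos
    rw [wishartWeight_of_posDef hX, wishartWeight_of_posDef hX,
      ← ENNReal.ofReal_mul (by positivity), mul_left_comm, ← Real.exp_add]
    refine ENNReal.ofReal_le_ofReal (mul_le_mul_of_nonneg_left (Real.exp_le_exp.2 ?_)
      (by positivity))
    nlinarith [mul_le_mul_of_nonneg_left htr (sub_nonneg.2 hε1)]
  rw [map_smul_wishart_apply p a n hA]
  calc Z⁻¹ * ∫⁻ X in (fun X => (n : ℝ)⁻¹ • X) ⁻¹' A, wishartWeight κ 1 X ∂hermLebesgue p
      ≤ Z⁻¹ * (ENNReal.ofReal (Real.exp (-(n * ((1 - ε) * t)))) * Zε) := by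
        refine mul_le_mul_right ?_ _
        refine (setLIntegral_mono' hms hpt).trans ((setLIntegral_le_lintegral _ _).trans_eq ?_)
        exact lintegral_const_mul' _ _ ENNReal.ofReal_ne_top
    _ = ENNReal.ofReal (Real.exp (-(n * ((1 - ε) * t)))) * ENNReal.ofReal (Z⁻¹ * Zε).toReal := by
        rw [ENNReal.ofReal_toReal hC, mul_left_comm]
    _ ≤ ENNReal.ofReal (Real.exp (-(n * s))) := by
        rw [← ENNReal.ofReal_mul (Real.exp_pos _).le]
        refine ENNReal.ofReal_le_ofReal ?_
        refine (mul_le_mul_of_nonneg_left hn (Real.exp_pos _).le).trans_eq ?_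
        rw [← Real.exp_add]
        congr 1
        ring

theorem EReal.inv_mul_log_ofReal_exp {n : ℕ} (hn : 1 ≤ n) (t : ℝ) :
    (((n : ℝ)⁻¹ : ℝ) : EReal) * (ENNReal.ofReal (Real.exp (-(n * t)))).log = -(t : EReal) := by
  have hn0 : (n : ℝ) ≠ 0 := by positivity
  rw [ENNReal.log_ofReal_of_pos (Real.exp_pos _), Real.log_exp, ← EReal.coe_mul, ← EReal.coe_neg]
  congr 1
  field_simp

theorem neg_le_liminf_inv_mul_log {u : ℕ → ℝ≥0∞} {t : ℝ}
    (h : ∀ᶠ n : ℕ in atTop, ENNReal.ofReal (Real.exp (-(n * t))) ≤ u n) :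
    -(t : EReal) ≤ liminf (fun n : ℕ => (((n : ℝ)⁻¹ : ℝ) : EReal) * (u n).log) atTop := by
  refine le_liminf_of_le (by isBoundedDefault) ?_
  filter_upwards [h, eventually_ge_atTop 1] with n hn hn1
  rw [← EReal.inv_mul_log_ofReal_exp hn1]
  exact mul_le_mul_of_nonneg_left (ENNReal.log_le_log hn)
    (EReal.coe_nonneg.2 (inv_nonneg.2 n.cast_nonneg))

theorem limsup_inv_mul_log_le_neg {u : ℕ → ℝ≥0∞} {t : ℝ}
    (h : ∀ᶠ n : ℕ in atTop, u n ≤ ENNReal.ofReal (Real.exp (-(n * t)))) :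
    limsup (fun n : ℕ => (((n : ℝ)⁻¹ : ℝ) : EReal) * (u n).log) atTop ≤ -(t : EReal) := by
  refine limsup_le_of_le (by isBoundedDefault) ?_
  filter_upwards [h, eventually_ge_atTop 1] with n hn hn1
  rw [← EReal.inv_mul_log_ofReal_exp hn1]
  exact mul_le_mul_of_nonneg_left (ENNReal.log_le_log hn)
    (EReal.coe_nonneg.2 (inv_nonneg.2 n.cast_nonneg))

theorem exists_posDef_mem_of_posSemidef {p : ℕ} {G : Set (Matrix (Fin p) (Fin p) ℂ)}
    (hG : IsOpen G) {X : Matrix (Fin p) (Fin p) ℂ} (hXG : X ∈ G) (hX : X.PosSemidef) {t : ℝ}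
    (ht : X.trace.re < t) : ∃ Y ∈ G, Y.PosDef ∧ Y.trace.re < t := by
  have hc : Continuous fun δ : ℝ => X + δ • (1 : Matrix (Fin p) (Fin p) ℂ) := by fun_prop
  have htr : Continuous fun δ : ℝ => (X + δ • (1 : Matrix (Fin p) (Fin p) ℂ)).trace.re := by
    fun_prop
  have h1 : ∀ᶠ δ : ℝ in 𝓝 0, X + δ • (1 : Matrix (Fin p) (Fin p) ℂ) ∈ G :=
    hc.continuousAt.eventually (hG.mem_nhds (by simpa using hXG))
  have h2 : ∀ᶠ δ : ℝ in 𝓝 0, (X + δ • (1 : Matrix (Fin p) (Fin p) ℂ)).trace.re < t :=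
    htr.continuousAt.eventually (gt_mem_nhds (by simpa using ht))
  obtain ⟨δ, ⟨hδ1, hδ2⟩, hδ⟩ := (((h1.and h2).filter_mono nhdsWithin_le_nhds).and
    (self_mem_nhdsWithin (s := Set.Ioi (0 : ℝ)))).exists
  exact ⟨_, hδ1, Matrix.PosDef.posSemidef_add hX (Matrix.PosDef.one.smul_real hδ), hδ2⟩

theorem posSemidefTrace_le_coe_iff {p : ℕ} {X : Matrix (Fin p) (Fin p) ℂ} {c : ℝ} :
    (if X.PosSemidef then ((X.trace.re : ℝ) : EReal) else ⊤) ≤ (c : EReal) ↔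
      X.PosSemidef ∧ X.trace.re ≤ c := by
  split_ifs with h <;> simp [h]

theorem isClosed_setOf_posSemidef_trace_le (p : ℕ) (c : ℝ) :
    IsClosed {X : Matrix (Fin p) (Fin p) ℂ | X.PosSemidef ∧ X.trace.re ≤ c} :=
  (isClosed_setOf_posSemidef p).inter (isClosed_le
    (f := fun X : Matrix (Fin p) (Fin p) ℂ => X.trace.re) (by fun_prop) continuous_const)

theorem isCompact_setOf_posSemidef_trace_le (p : ℕ) (c : ℝ) :
    IsCompact {X : Matrix (Fin p) (Fin p) ℂ | X.PosSemidef ∧ X.trace.re ≤ c} := by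
  have hK : IsCompact (Set.univ.pi fun _ : Fin p => Set.univ.pi fun _ : Fin p =>
      Metric.closedBall (0 : ℂ) c) :=
    isCompact_univ_pi fun _ => isCompact_univ_pi fun _ => isCompact_closedBall _ _
  refine hK.of_isClosed_subset (isClosed_setOf_posSemidef_trace_le p c) ?_
  rintro X ⟨hX, hc⟩ i - j -
  simpa using (hX.norm_apply_le_trace i j).trans hc

theorem lowerSemicontinuous_posSemidefTrace (p : ℕ) :
    LowerSemicontinuous fun X : Matrix (Fin p) (Fin p) ℂ =>
      if X.PosSemidef then ((X.trace.re : ℝ) : EReal) else ⊤ := by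
  intro X y hy
  obtain ⟨c, hyc, hc⟩ := EReal.lt_iff_exists_real_btwn.1 hy
  have hmem : X ∈ {X : Matrix (Fin p) (Fin p) ℂ | X.PosSemidef ∧ X.trace.re ≤ c}ᶜ :=
    fun h => hc.not_ge (posSemidefTrace_le_coe_iff.2 h)
  filter_upwards [(isClosed_setOf_posSemidef_trace_le p c).isOpen_compl.mem_nhds hmem] with Y hY
  exact hyc.trans (not_le.1 fun h => hY (posSemidefTrace_le_coe_iff.1 h))

/-- If `X ~ W_p(a)` with `a > p - 1`, then `X / n` satisfies an LDP with speed `n` and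
good rate function `I(X) = tr X` on positive semidefinite Hermitian matrices. -/
theorem wishart_scaled_LDP (p : ℕ) (a : ℝ) (ha : (p : ℝ) - 1 < a) :
    IsLDP
      (fun n => Measure.map (fun X : Matrix (Fin p) (Fin p) ℂ => ((n : ℝ)⁻¹) • X)
        (wishart p a))
      (fun X => if X.PosSemidef then ((X.trace.re : ℝ) : EReal) else ⊤) := by
  refine ⟨lowerSemicontinuous_posSemidefTrace p, fun c => ?_, fun A hA => ⟨?_, ?_⟩⟩
  · simp only [posSemidefTrace_le_coe_iff]
    exact isCompact_setOf_posSemidef_trace_le p c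
  · rw [EReal.neg_le]
    refine le_iInf₂ fun X hXA => ?_
    refine EReal.le_of_forall_lt_iff_le.1 fun t ht => ?_
    obtain ⟨s, hXs, hst⟩ := EReal.lt_iff_exists_real_btwn.1 ht
    obtain ⟨hX, hXs'⟩ := posSemidefTrace_le_coe_iff.1 hXs.le
    obtain ⟨Y, hYA, hY, hYt⟩ := exists_posDef_mem_of_posSemidef isOpen_interior hXA hX
      (hXs'.trans_lt (EReal.coe_lt_coe_iff.1 hst))
    rw [EReal.neg_le]
    exact neg_le_liminf_inv_mul_log (eventually_le_map_smul_wishart ha hA hYA hY hYt)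
  · rw [EReal.le_neg]
    refine EReal.ge_of_forall_gt_iff_ge.1 fun s hs => ?_
    obtain ⟨t, hst, ht⟩ := EReal.lt_iff_exists_real_btwn.1 hs
    rw [EReal.le_neg]
    refine limsup_inv_mul_log_le_neg (eventually_map_smul_wishart_le ha hA
      (EReal.coe_lt_coe_iff.1 hst) fun X hXA hX => ?_)
    have := ht.le.trans (iInf₂_le X (subset_closure hXA))
    simp only [if_pos hX] at this
    exact EReal.coe_le_coe_iff.1 this
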